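/- arXiv:2510.02471 — 3 statements merged into one kernel-verified Lean document; each statement's English description precedes it below -/
import Mathlib

section
/- Pretrained conformal coverage for β-mixing data: under the setting of the pretrained coverage theorem, if additionally Z is stationary with β-mixing coefficients β(τ), then P(Y_{n+1} ∈ Ĉ_n) ≥ 1 − α − min_{τ ∈ {0,...,n-2L}} { (τ+L)/(n-L+1) + 2β(τ) }. -/
open MeasureTheory
open scoped ENNReal

/-- The `j`-th order statistic (1-indexed) of a finite real vector. -/
noncomputable def orderStat {m : ℕ} (v : Fin m → ℝ) (j : ℕ) : ℝ :=
  ((List.ofFn v).mergeSort (fun x y => x ≤ y)).getD (j - 1) 0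

/-- `Quantile b v` is the `⌈b·m⌉`-th order statistic of `v ∈ ℝ^m`, with the conventions
`Quantile b v = ⊤` if `b > 1` and `Quantile b v = ⊥` if `b ≤ 0`. -/
noncomputable def Quantile {m : ℕ} (b : ℝ) (v : Fin m → ℝ) : EReal :=
  if b > 1 then ⊤ else if b ≤ 0 then ⊥ else ((orderStat v ⌈b * m⌉.toNat : ℝ) : EReal)

/-- The deletion operator `Δ⁰_{k,τ}` of the paper (with `k` and `τ` counts of entries). -/
def delta0 {α : Type*} (m k τ : ℕ) (w : Fin m → α) : Fin (m - τ) → α :=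
  fun i =>
    if i.val < m - τ - k then w ⟨i.val, by have := i.isLt; omega⟩
    else w ⟨i.val + τ, by have := i.isLt; omega⟩

/-- The deletion operator `Δ¹_{k,τ}` of the paper. -/
def delta1 {α : Type*} (m k τ : ℕ) (w : Fin m → α) : Fin (m - τ) → α :=
  fun i =>
    if h : k + τ < m then
      if h2 : i.val < m - τ - k then w ⟨i.val + k + τ, by have := i.isLt; omega⟩
      else w ⟨i.val - (m - τ - k), by have := i.isLt; omega⟩
    else w ⟨(i.val + k + τ - m) % m, Nat.mod_lt _ (by have := i.isLt; omega)⟩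

/-- Total variation distance between the laws of two random elements `U, V` under `P`. -/
noncomputable def dTV {Ω γ : Type*} [MeasurableSpace Ω] [MeasurableSpace γ]
    (P : Measure Ω) (U V : Ω → γ) : ℝ :=
  ⨆ E : {E : Set γ // MeasurableSet E}, |(P (U ⁻¹' E.1)).toReal - (P (V ⁻¹' E.1)).toReal|

/-- The switch coefficient `Ψ_{k,τ}(W)` of a random vector `W` of length `m`. -/
noncomputable def switchCoef {Ω α : Type*} [MeasurableSpace Ω] [MeasurableSpace α]
    (P : Measure Ω) {m : ℕ} (W : Ω → Fin m → α) (k τ : ℕ) : ℝ :=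
  dTV P (fun ω => delta0 m k τ (W ω)) (fun ω => delta1 m k τ (W ω))

/-- The averaged switch coefficient `Ψ̄_τ(W) = (1/m) ∑_{k=1}^m Ψ_{k,τ}(W)`. -/
noncomputable def avgSwitchCoef {Ω α : Type*} [MeasurableSpace Ω] [MeasurableSpace α]
    (P : Measure Ω) {m : ℕ} (W : Ω → Fin m → α) (τ : ℕ) : ℝ :=
  (∑ k ∈ Finset.Icc 1 m, switchCoef P W k τ) / m

/-- Stationarity of a time series `Z = (Z_1,…,Z_{n+1})`. -/
def Stationary {Ω α : Type*} [MeasurableSpace Ω] [MeasurableSpace α]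
    (P : Measure Ω) {n : ℕ} (Z : Ω → Fin (n + 1) → α) : Prop :=
  ∀ (ℓ i : ℕ) (h : i + ℓ ≤ n + 1),
    Measure.map (fun ω (j : Fin ℓ) => Z ω ⟨i + j.val, by have := j.isLt; omega⟩) P =
      Measure.map (fun ω (j : Fin ℓ) => Z ω ⟨j.val, by have := j.isLt; omega⟩) P

/-- Exchangeability of a random vector. -/
def Exchangeable {Ω α : Type*} [MeasurableSpace Ω] [MeasurableSpace α]
    (P : Measure Ω) {n : ℕ} (Z : Ω → Fin (n + 1) → α) : Prop :=
  ∀ σ : Equiv.Perm (Fin (n + 1)),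
    Measure.map (fun ω => Z ω ∘ σ) P = Measure.map Z P

/-- The β-mixing coefficient with lag `τ` of `Z`, defined via an independent copy `Z'`. -/
noncomputable def betaMix {Ω α : Type*} [MeasurableSpace Ω] [MeasurableSpace α]
    (P : Measure Ω) (n : ℕ) (Z Z' : Ω → Fin (n + 1) → α) (τ : ℕ) : ℝ :=
  ⨆ k : Fin (n - τ),
    dTV P
      (fun ω (i : Fin (n + 1 - τ)) =>
        if i.val < k.val + 1 then Z ω ⟨i.val, by have := i.isLt; omega⟩
        else Z ω ⟨i.val + τ, by have := i.isLt; omega⟩)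
      (fun ω (i : Fin (n + 1 - τ)) =>
        if i.val < k.val + 1 then Z ω ⟨i.val, by have := i.isLt; omega⟩
        else Z' ω ⟨i.val + τ, by have := i.isLt; omega⟩)

/-- A finite series, extended to `ℕ` by repeating its last entry. -/
def path {α : Type*} {n : ℕ} (z : Fin (n + 1) → α) (j : ℕ) : α :=
  z ⟨min j n, by omega⟩

/-- The block of `p` entries of `z` starting at index `i`, extended to `ℕ` by repeating its last
entry. -/
def block {α : Type*} {n : ℕ} (i p : ℕ) (z : Fin (n + 1) → α) (j : ℕ) : α :=
  path z (i + min j (p - 1))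

/-- The score at index `j`, computed from the entries `j, …, j + L`. -/
def score {α : Type*} {L : ℕ} (s : (Fin (L + 1) → α) → ℝ) (x : ℕ → α) (j : ℕ) : ℝ :=
  s fun l : Fin (L + 1) => x (L + j - l.val)

/-- The number of indices `i < N` with `f i < t`. -/
noncomputable def numBelow (f : ℕ → ℝ) (N : ℕ) (t : ℝ) : ℕ :=
  ((Finset.range N).filter fun i => f i < t).card

section Counting

theorem numBelow_congr {f g : ℕ → ℝ} {N : ℕ} {t u : ℝ} (h : ∀ i < N, f i = g i) (htu : t = u) :
    numBelow f N t = numBelow g N u := by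
  subst htu
  unfold numBelow
  congr 1
  apply Finset.filter_congr
  intro i hi
  rw [h i (Finset.mem_range.1 hi)]

theorem numBelow_add (f : ℕ → ℝ) (A B : ℕ) (t : ℝ) :
    numBelow f (A + B) t = numBelow f A t + numBelow (fun i => f (A + i)) B t := by
  simp only [numBelow, Finset.card_filter, Finset.sum_range_add]

theorem numBelow_le (f : ℕ → ℝ) (N : ℕ) (t : ℝ) : numBelow f N t ≤ N := by
  simpa only [numBelow, Finset.card_range] using
    Finset.card_filter_le (Finset.range N) (fun i => f i < t)

/-- At most `m - c` entries of a vector of length `m` have at least `c` entries below them. -/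
theorem card_le_numBelow (f : ℕ → ℝ) (m : ℕ) (c : ℝ) (hc : c ≤ m) :
    (((Finset.range m).filter fun k => c ≤ numBelow f m (f k)).card : ℝ) ≤ m - c := by
  set A := (Finset.range m).filter fun k => c ≤ numBelow f m (f k) with hA
  rcases A.eq_empty_or_nonempty with h | h
  · rw [h]; simpa using hc
  · obtain ⟨k, hk, hmin⟩ := A.exists_min_image f h
    have hck : c ≤ numBelow f m (f k) := (Finset.mem_filter.1 hk).2
    have hdisj : Disjoint A ((Finset.range m).filter fun i => f i < f k) := by
      rw [Finset.disjoint_left]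
      intro i hi hi'
      exact absurd (Finset.mem_filter.1 hi').2 (not_lt.2 (hmin i hi))
    have hcard : A.card + numBelow f m (f k) ≤ m := by
      rw [numBelow, ← Finset.card_union_of_disjoint hdisj]
      have hsub : A ∪ (Finset.range m).filter (fun i => f i < f k) ⊆ Finset.range m :=
        Finset.union_subset (Finset.filter_subset _ _) (Finset.filter_subset _ _)
      simpa only [Finset.card_range] using Finset.card_le_card hsub
    have : (A.card : ℝ) + numBelow f m (f k) ≤ m := by exact_mod_cast hcard
    linarith

theorem le_countP_of_sorted {l : List ℝ} (hl : l.Pairwise (· ≤ ·)) {j : ℕ} (hj : 1 ≤ j)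
    (hjl : j ≤ l.length) {t : ℝ} (ht : l.getD (j - 1) 0 < t) :
    j ≤ l.countP (fun x => decide (x < t)) := by
  have h1 : (l.take j).countP (fun x => decide (x < t)) = (l.take j).length := by
    rw [List.countP_eq_length]
    intro x hx
    obtain ⟨i, hi, rfl⟩ := List.mem_iff_getElem.1 hx
    have hij : i < j := by
      rw [List.length_take] at hi; omega
    rw [List.getElem_take, decide_eq_true_iff]
    rw [List.getD_eq_getElem _ _ (by omega)] at ht
    refine lt_of_le_of_lt ?_ ht
    rcases Nat.lt_or_ge i (j - 1) with h | h
    · exact List.pairwise_iff_getElem.1 hl _ _ _ _ h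
    · have : i = j - 1 := by omega
      subst this; exact le_rfl
  have h2 := (List.take_sublist j l).countP_le (p := fun x => decide (x < t))
  rw [h1, List.length_take] at h2
  omega

theorem countP_ofFn (f : ℕ → ℝ) (M : ℕ) (t : ℝ) :
    (List.ofFn fun i : Fin M => f i).countP (fun x => decide (x < t)) = numBelow f M t := by
  induction M with
  | zero => simp [numBelow]
  | succ M ih =>
    rw [numBelow_add, ← ih, List.ofFn_succ', List.concat_eq_append, List.countP_append]
    congr 1
    by_cases h : f M < t <;> simp [numBelow, Finset.filter_singleton, h]

theorem le_numBelow_of_orderStat_lt {f : ℕ → ℝ} {M j : ℕ} (hj : 1 ≤ j) (hjM : j ≤ M) {t : ℝ}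
    (ht : orderStat (fun i : Fin M => f i) j < t) : j ≤ numBelow f M t := by
  rw [← countP_ofFn, ← (List.mergeSort_perm _ (fun x y => decide (x ≤ y))).countP_eq]
  refine le_countP_of_sorted ?_ hj (by simpa using hjM) ht
  have := List.pairwise_mergeSort (le := fun x y : ℝ => decide (x ≤ y))
    (fun a b c h1 h2 => by simp only [decide_eq_true_iff] at *; exact h1.trans h2)
    (fun a b => by simpa using le_total a b) (List.ofFn fun i : Fin M => f i)
  simpa using this

theorem le_Quantile_of_numBelow_lt {f : ℕ → ℝ} {M : ℕ} (hM : 0 < M) {a : ℝ} (ha1 : a < 1)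
    (h : (numBelow f (M + 1) (f M) : ℝ) < (1 - a) * (M + 1)) :
    (f M : EReal) ≤ Quantile ((1 - a) * (1 + 1 / (M : ℝ))) (fun i : Fin M => f i) := by
  have hM' : (0 : ℝ) < M := by exact_mod_cast hM
  have hb0 : 0 < (1 - a) * (1 + 1 / (M : ℝ)) := mul_pos (by linarith) (by positivity)
  have hbM : (1 - a) * (1 + 1 / (M : ℝ)) * M = (1 - a) * (M + 1) := by field_simp
  unfold Quantile
  split_ifs with h1 h2
  · exact le_top
  · exact absurd hb0 (not_lt.2 h2)
  · rw [EReal.coe_le_coe_iff]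
    by_contra! hlt
    rw [hbM, Int.ceil_toNat] at hlt
    have hj1 : 1 ≤ ⌈(1 - a) * ((M : ℝ) + 1)⌉₊ :=
      Nat.one_le_ceil_iff.2 (mul_pos (by linarith) (by positivity))
    have hjM : ⌈(1 - a) * ((M : ℝ) + 1)⌉₊ ≤ M := by
      rw [Nat.ceil_le, ← hbM]
      nlinarith [not_lt.1 h1]
    have hle := le_numBelow_of_orderStat_lt hj1 hjM hlt
    have hle' : numBelow f M (f M) ≤ numBelow f (M + 1) (f M) := by
      rw [numBelow_add]; omega
    have h3 := Nat.ceil_le.1 (hle.trans hle')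
    linarith

end Counting

section Blocks

theorem score_block {α : Type*} {L n : ℕ} (s : (Fin (L + 1) → α) → ℝ) (z : Fin (n + 1) → α)
    {i p j : ℕ} (h : L + j < p) : score s (block i p z) j = score s (path z) (i + j) := by
  unfold score block
  congr 1
  funext l
  congr 1
  have := l.isLt
  omega

variable {Ω α : Type*} [MeasurableSpace Ω] [MeasurableSpace α]

theorem measurable_path {n : ℕ} : Measurable (path : (Fin (n + 1) → α) → ℕ → α) :=
  measurable_pi_lambda _ fun _ => measurable_pi_apply _

theorem measurable_block {n : ℕ} (i p : ℕ) :
    Measurable (block i p : (Fin (n + 1) → α) → ℕ → α) :=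
  measurable_pi_lambda _ fun _ => measurable_pi_apply _

theorem measurable_score {L : ℕ} {s : (Fin (L + 1) → α) → ℝ} (hs : Measurable s) (j : ℕ) :
    Measurable fun x : ℕ → α => score s x j :=
  hs.comp (measurable_pi_lambda _ fun _ => measurable_pi_apply _)

theorem measurable_numBelow {X : Type*} [MeasurableSpace X] {f : X → ℕ → ℝ} {t : X → ℝ}
    (hf : ∀ i, Measurable fun x => f x i) (ht : Measurable t) (N : ℕ) :
    Measurable fun x => (numBelow (f x) N (t x) : ℝ) := by
  simp only [numBelow, Finset.card_filter, Nat.cast_sum]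
  refine Finset.measurable_sum _ fun i _ => ?_
  push_cast
  exact Measurable.ite (measurableSet_lt (hf i) ht) measurable_const measurable_const

/-- For a stationary series, the law of a block depends only on its length. -/
theorem map_block_eq {P : Measure Ω} {n : ℕ} {Z : Ω → Fin (n + 1) → α} (hZ : Measurable Z)
    (hst : Stationary P Z) {i p : ℕ} (hp : 0 < p) (h : i + p ≤ n + 1) :
    P.map (fun ω => block i p (Z ω)) = P.map (fun ω => block 0 p (Z ω)) := by
  let e : (Fin p → α) → ℕ → α := fun v j => v ⟨min j (p - 1), by omega⟩
  have he : Measurable e := measurable_pi_lambda _ fun _ => measurable_pi_apply _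
  have key := congrArg (Measure.map e) (hst p i h)
  have hm : ∀ f : Fin p → Fin (n + 1), Measurable fun ω (j : Fin p) => Z ω (f j) := fun f =>
    measurable_pi_lambda _ fun j => (measurable_pi_apply _).comp hZ
  rw [Measure.map_map he (hm _), Measure.map_map he (hm _)] at key
  convert key using 2
  · funext ω j
    simp only [block, path, e, Function.comp]
    congr 2
    omega
  · funext ω j
    simp only [block, path, e, Function.comp]
    congr 2
    omega

theorem abs_sub_le_one (P : Measure Ω) [IsProbabilityMeasure P] (A B : Set Ω) :
    |P.real A - P.real B| ≤ 1 := by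
  rw [abs_le]
  constructor <;> linarith [measureReal_nonneg (μ := P) (s := A),
    measureReal_nonneg (μ := P) (s := B), measureReal_le_one (μ := P) (s := A),
    measureReal_le_one (μ := P) (s := B)]

theorem abs_sub_le_dTV {γ : Type*} [MeasurableSpace γ] (P : Measure Ω) [IsProbabilityMeasure P]
    (U V : Ω → γ) {E : Set γ} (hE : MeasurableSet E) :
    |P.real (U ⁻¹' E) - P.real (V ⁻¹' E)| ≤ dTV P U V :=
  le_ciSup (f := fun E : {E : Set γ // MeasurableSet E} =>
      |(P (U ⁻¹' E.1)).toReal - (P (V ⁻¹' E.1)).toReal|)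
    ⟨1, by rintro _ ⟨E, rfl⟩; exact abs_sub_le_one P _ _⟩ ⟨E, hE⟩

theorem dTV_nonneg {γ : Type*} [MeasurableSpace γ] (P : Measure Ω) (U V : Ω → γ) :
    0 ≤ dTV P U V :=
  Real.iSup_nonneg fun _ => abs_nonneg _

theorem betaMix_nonneg (P : Measure Ω) {n : ℕ} (Z Z' : Ω → Fin (n + 1) → α) (τ : ℕ) :
    0 ≤ betaMix P n Z Z' τ :=
  Real.iSup_nonneg fun _ => dTV_nonneg _ _ _

/-- Two blocks of `Z` separated by a gap of length `τ` are within `β(τ)` of being independent. -/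
theorem abs_sub_le_betaMix (P : Measure Ω) [IsProbabilityMeasure P] {n : ℕ}
    (Z Z' : Ω → Fin (n + 1) → α) {τ p q : ℕ} (hp : 0 < p) (hq : 0 < q) (hpq : p + τ + q = n + 1)
    {E : Set ((ℕ → α) × (ℕ → α))} (hE : MeasurableSet E) :
    |P.real {ω | (block 0 p (Z ω), block (p + τ) q (Z ω)) ∈ E} -
      P.real {ω | (block 0 p (Z ω), block (p + τ) q (Z' ω)) ∈ E}| ≤ betaMix P n Z Z' τ := by
  let e : (Fin (n + 1 - τ) → α) → (ℕ → α) × (ℕ → α) := fun v =>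
    (fun j => v ⟨min j (p - 1), by omega⟩, fun j => v ⟨p + min j (q - 1), by omega⟩)
  have he : Measurable e :=
    (measurable_pi_lambda _ fun _ => measurable_pi_apply _).prodMk
      (measurable_pi_lambda _ fun _ => measurable_pi_apply _)
  have hle := le_ciSup (f := fun k : Fin (n - τ) =>
    dTV P
      (fun ω (i : Fin (n + 1 - τ)) =>
        if i.val < k.val + 1 then Z ω ⟨i.val, by have := i.isLt; omega⟩
        else Z ω ⟨i.val + τ, by have := i.isLt; omega⟩)
      (fun ω (i : Fin (n + 1 - τ)) =>
        if i.val < k.val + 1 then Z ω ⟨i.val, by have := i.isLt; omega⟩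
        else Z' ω ⟨i.val + τ, by have := i.isLt; omega⟩))
    (Set.finite_range _).bddAbove ⟨p - 1, by omega⟩
  refine le_trans ?_ ((abs_sub_le_dTV P _ _ (he hE)).trans hle)
  apply le_of_eq
  have hfst : ∀ j, min j (p - 1) < p - 1 + 1 := fun j => by omega
  have hsnd : ∀ j, ¬ p + min j (q - 1) < p - 1 + 1 := fun j => by omega
  have hpair : ∀ W : Ω → Fin (n + 1) → α, ∀ ω,
      e (fun i : Fin (n + 1 - τ) =>
        if i.val < p - 1 + 1 then Z ω ⟨i.val, by have := i.isLt; omega⟩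
        else W ω ⟨i.val + τ, by have := i.isLt; omega⟩) =
      (block 0 p (Z ω), block (p + τ) q (W ω)) := by
    intro W ω
    refine Prod.ext ?_ ?_
    · funext j
      simp only [e, hfst, if_true, block, path]
      congr 2
      omega
    · funext j
      simp only [e, hsnd, if_false, block, path]
      congr 2
      omega
  congr 3
  · ext ω
    simp only [Set.mem_ofPred_eq, Set.mem_preimage, hpair]
  · ext ω
    simp only [Set.mem_ofPred_eq, Set.mem_preimage, hpair]

/-- Exchanging the order of two blocks separated by a gap of length `τ` changes probabilities by at
most `2 β(τ)`. -/
theorem abs_sub_le_two_mul_betaMix (P : Measure Ω) [IsProbabilityMeasure P] {n : ℕ}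
    {Z Z' : Ω → Fin (n + 1) → α} (hZ : Measurable Z) (hZ' : Measurable Z')
    (hst : Stationary P Z) (hcopy : Measure.map Z' P = Measure.map Z P)
    (hindep : ProbabilityTheory.IndepFun Z Z' P)
    {τ p q : ℕ} (hp : 0 < p) (hq : 0 < q) (hpq : p + τ + q = n + 1)
    {E : Set ((ℕ → α) × (ℕ → α))} (hE : MeasurableSet E) :
    |P.real {ω | (block 0 p (Z ω), block (p + τ) q (Z ω)) ∈ E} -
      P.real {ω | (block (q + τ) p (Z ω), block 0 q (Z ω)) ∈ E}| ≤
        2 * betaMix P n Z Z' τ := by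
  have hind : ∀ {p q : ℕ}, 0 < q → p + τ + q = n + 1 →
      P.map (fun ω => (block 0 p (Z ω), block (p + τ) q (Z' ω))) =
        (P.map fun ω => block 0 p (Z ω)).prod (P.map fun ω => block 0 q (Z ω)) := by
    intro p q hq hpq
    have hi := hindep.comp (measurable_block (α := α) (n := n) 0 p)
      (measurable_block (α := α) (n := n) (p + τ) q)
    have h1 := (ProbabilityTheory.indepFun_iff_map_prod_eq_prod_map_map
      ((measurable_block 0 p).comp hZ).aemeasurable
      ((measurable_block (p + τ) q).comp hZ').aemeasurable).1 hi
    have h2 : P.map (block (p + τ) q ∘ Z') = P.map (fun ω => block 0 q (Z ω)) := by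
      rw [← Measure.map_map (measurable_block _ _) hZ', hcopy,
        Measure.map_map (measurable_block _ _) hZ]
      exact map_block_eq hZ hst hq (by omega)
    rw [h2] at h1
    exact h1
  have hprob : ∀ {p q : ℕ}, 0 < q → p + τ + q = n + 1 → ∀ {E : Set ((ℕ → α) × (ℕ → α))},
      MeasurableSet E → P.real {ω | (block 0 p (Z ω), block (p + τ) q (Z' ω)) ∈ E} =
        ((P.map fun ω => block 0 p (Z ω)).prod (P.map fun ω => block 0 q (Z ω))).real E := by
    intro p q hq hpq E hE
    rw [← hind hq hpq]
    exact (map_measureReal_apply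
      (((measurable_block 0 p).comp hZ).prodMk ((measurable_block (p + τ) q).comp hZ')) hE).symm
  have hA := abs_sub_le_betaMix P Z Z' hp hq hpq hE
  have hB := abs_sub_le_betaMix P Z Z' hq hp (by omega : q + τ + p = n + 1)
    (measurable_swap hE)
  rw [hprob hq hpq hE] at hA
  rw [hprob hp (by omega) (measurable_swap hE)] at hB
  have hswap : ((P.map fun ω => block 0 q (Z ω)).prod (P.map fun ω => block 0 p (Z ω))).real
      (Prod.swap ⁻¹' E) =
      ((P.map fun ω => block 0 p (Z ω)).prod (P.map fun ω => block 0 q (Z ω))).real E := by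
    have : IsProbabilityMeasure (P.map fun ω => block 0 p (Z ω)) :=
      Measure.isProbabilityMeasure_map ((measurable_block 0 p).comp hZ).aemeasurable
    have : IsProbabilityMeasure (P.map fun ω => block 0 q (Z ω)) :=
      Measure.isProbabilityMeasure_map ((measurable_block 0 q).comp hZ).aemeasurable
    rw [← map_measureReal_apply measurable_swap hE, Measure.prod_swap]
  rw [hswap] at hB
  change |P.real {ω | (block (q + τ) p (Z ω), block 0 q (Z ω)) ∈ E} - _| ≤ _ at hB
  rw [abs_le] at *
  constructor <;> linarith [hA.1, hA.2, hB.1, hB.2]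

end Blocks

section Coverage

variable {Ω α : Type*} [MeasurableSpace Ω] [MeasurableSpace α]

theorem measurableSet_le_numBelow {n L : ℕ} {Z : Ω → Fin (n + 1) → α} (hZ : Measurable Z)
    {s : (Fin (L + 1) → α) → ℝ} (hs : Measurable s) (m k : ℕ) (c : ℝ) :
    MeasurableSet
      {ω | c ≤ numBelow (score s (path (Z ω))) m (score s (path (Z ω)) k)} := by
  have h : ∀ j, Measurable fun ω => score s (path (Z ω)) j := fun j =>
    (measurable_score hs j).comp (measurable_path.comp hZ)
  exact measurableSet_le measurable_const (measurable_numBelow h (h k) m)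

/-- After dropping `τ + L` scores, the last score may be replaced by the score at any index `k`, at
the cost of `2 β(τ)` in probability. -/
theorem prob_rank_last_le (P : Measure Ω) [IsProbabilityMeasure P] {n L : ℕ}
    {Z Z' : Ω → Fin (n + 1) → α} (hZ : Measurable Z) (hZ' : Measurable Z')
    (hst : Stationary P Z) (hcopy : Measure.map Z' P = Measure.map Z P)
    (hindep : ProbabilityTheory.IndepFun Z Z' P)
    {s : (Fin (L + 1) → α) → ℝ} (hs : Measurable s) {m τ k : ℕ} (hm : m + L = n + 1)
    (hτ : τ + L < m) (hk : k < m) (c : ℝ) :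
    P.real {ω | c ≤ numBelow (score s (path (Z ω))) m (score s (path (Z ω)) (m - 1))} ≤
      P.real {ω | c - (τ + L) ≤ numBelow (score s (path (Z ω))) m (score s (path (Z ω)) k)} +
        2 * betaMix P n Z Z' τ := by
  rcases Nat.lt_or_ge (k + 1 + (τ + L)) m with hkm | hkm
  · obtain ⟨r, hr⟩ : ∃ r, m = r + (τ + L) + (k + 1) := ⟨m - (τ + L) - (k + 1), by omega⟩
    let E : Set ((ℕ → α) × (ℕ → α)) := {x | c - (τ + L) ≤
      (numBelow (score s x.1) r (score s x.2 k) : ℝ) +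
        numBelow (score s x.2) (k + 1) (score s x.2 k)}
    have hE : MeasurableSet E := by
      have h1 : ∀ j, Measurable fun x : (ℕ → α) × (ℕ → α) => score s x.1 j := fun j =>
        (measurable_score hs j).comp measurable_fst
      have h2 : ∀ j, Measurable fun x : (ℕ → α) × (ℕ → α) => score s x.2 j := fun j =>
        (measurable_score hs j).comp measurable_snd
      exact measurableSet_le measurable_const
        ((measurable_numBelow h1 (h2 k) r).add (measurable_numBelow h2 (h2 k) (k + 1)))
    have key := (abs_le.1 (abs_sub_le_two_mul_betaMix P hZ hZ' hst hcopy hindep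
      (τ := τ) (p := r + L) (q := k + 1 + L) (by omega) (by omega) (by omega) hE)).2
    have h1 : P.real {ω | c ≤ numBelow (score s (path (Z ω))) m (score s (path (Z ω)) (m - 1))} ≤
        P.real {ω | (block 0 (r + L) (Z ω), block (r + L + τ) (k + 1 + L) (Z ω)) ∈ E} := by
      refine measureReal_mono fun ω hω => ?_
      simp only [Set.mem_ofPred_eq, E] at hω ⊢
      have ht : score s (block (r + L + τ) (k + 1 + L) (Z ω)) k =
          score s (path (Z ω)) (m - 1) := by
        rw [score_block s _ (by omega)]; congr 1; omega
      rw [ht]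
      rw [numBelow_congr (f := score s (block 0 (r + L) (Z ω))) (g := score s (path (Z ω)))
        (fun i hi => by rw [score_block s _ (by omega), zero_add]) rfl,
        numBelow_congr (f := score s (block (r + L + τ) (k + 1 + L) (Z ω)))
        (g := fun i => score s (path (Z ω)) (r + (τ + L) + i))
        (fun i hi => by rw [score_block s _ (by omega)]; congr 1; omega) rfl]
      generalize score s (path (Z ω)) (m - 1) = t at hω ⊢
      rw [hr, numBelow_add, numBelow_add] at hω
      have := numBelow_le (fun i => score s (path (Z ω)) (r + i)) (τ + L) t
      have : (numBelow (fun i => score s (path (Z ω)) (r + i)) (τ + L) t : ℝ) ≤ τ + L := by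
        exact_mod_cast this
      push_cast at hω
      linarith
    have h2 : P.real {ω | (block (k + 1 + L + τ) (r + L) (Z ω), block 0 (k + 1 + L) (Z ω)) ∈ E} ≤
        P.real {ω | c - (τ + L) ≤
          numBelow (score s (path (Z ω))) m (score s (path (Z ω)) k)} := by
      refine measureReal_mono fun ω hω => ?_
      simp only [Set.mem_ofPred_eq, E] at hω ⊢
      have ht : score s (block 0 (k + 1 + L) (Z ω)) k = score s (path (Z ω)) k := by
        rw [score_block s _ (by omega), zero_add]
      rw [ht] at hω
      rw [numBelow_congr (f := score s (block (k + 1 + L + τ) (r + L) (Z ω)))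
        (g := fun i => score s (path (Z ω)) (k + 1 + (L + τ) + i))
        (fun i hi => by rw [score_block s _ (by omega)]; congr 1; omega) rfl,
        numBelow_congr (f := score s (block 0 (k + 1 + L) (Z ω))) (g := score s (path (Z ω)))
        (fun i hi => by rw [score_block s _ (by omega), zero_add]) rfl] at hω
      generalize score s (path (Z ω)) k = t at hω ⊢
      have hm' : m = k + 1 + (L + τ) + r := by omega
      rw [hm', numBelow_add, numBelow_add]
      push_cast
      linarith [(Nat.cast_nonneg _ :
        (0 : ℝ) ≤ numBelow (fun i => score s (path (Z ω)) (k + 1 + i)) (L + τ) t)]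
    linarith
  · obtain ⟨r, hr⟩ : ∃ r, m = τ + L + r + 1 := ⟨m - (τ + L) - 1, by omega⟩
    obtain ⟨i₀, hi₀⟩ : ∃ i₀, k = i₀ + r := ⟨k - r, by omega⟩
    let E : Set (ℕ → α) := {x | c - (τ + L) ≤ (numBelow (score s x) (r + 1) (score s x r) : ℝ)}
    have hE : MeasurableSet E := measurableSet_le measurable_const
      (measurable_numBelow (measurable_score hs) (measurable_score hs r) (r + 1))
    have hlaw : ∀ i, i + (r + 1 + L) ≤ n + 1 → P.real {ω | block i (r + 1 + L) (Z ω) ∈ E} =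
        (P.map fun ω => block 0 (r + 1 + L) (Z ω)).real E := fun i hi => by
      rw [← map_block_eq hZ hst (by omega) hi]
      exact (map_measureReal_apply ((measurable_block _ _).comp hZ) hE).symm
    have hmem : ∀ i ω, block i (r + 1 + L) (Z ω) ∈ E ↔ c - (τ + L) ≤
        (numBelow (fun j => score s (path (Z ω)) (i + j)) (r + 1)
          (score s (path (Z ω)) (i + r)) : ℝ) := by
      intro i ω
      simp only [E, Set.mem_ofPred_eq]
      rw [numBelow_congr (g := fun j => score s (path (Z ω)) (i + j))
        (fun j hj => score_block s _ (by omega)) (score_block s _ (by omega))]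
    have h1 : P.real {ω | c ≤ numBelow (score s (path (Z ω))) m (score s (path (Z ω)) (m - 1))} ≤
        P.real {ω | block (τ + L) (r + 1 + L) (Z ω) ∈ E} := by
      refine measureReal_mono fun ω hω => ?_
      simp only [Set.mem_ofPred_eq, hmem] at hω ⊢
      rw [show m - 1 = τ + L + r by omega] at hω
      generalize score s (path (Z ω)) (τ + L + r) = t at hω ⊢
      rw [show m = τ + L + (r + 1) by omega, numBelow_add] at hω
      have := numBelow_le (score s (path (Z ω))) (τ + L) t
      have : (numBelow (score s (path (Z ω))) (τ + L) t : ℝ) ≤ τ + L := by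
        exact_mod_cast this
      push_cast at hω
      linarith
    have h2 : P.real {ω | block i₀ (r + 1 + L) (Z ω) ∈ E} ≤ P.real {ω | c - (τ + L) ≤
          numBelow (score s (path (Z ω))) m (score s (path (Z ω)) k)} := by
      refine measureReal_mono fun ω hω => ?_
      simp only [Set.mem_ofPred_eq, hmem] at hω ⊢
      rw [hi₀]
      refine hω.trans ?_
      rw [show m = i₀ + (r + 1) + (m - 1 - k) by omega, numBelow_add _ (i₀ + (r + 1)),
        numBelow_add _ i₀ (r + 1)]
      push_cast
      linarith [(Nat.cast_nonneg _ : (0 : ℝ) ≤ numBelow (score s (path (Z ω))) i₀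
          (score s (path (Z ω)) (i₀ + r))),
        (Nat.cast_nonneg _ : (0 : ℝ) ≤ numBelow
          (fun i => score s (path (Z ω)) (i₀ + (r + 1) + i)) (m - 1 - k)
          (score s (path (Z ω)) (i₀ + r)))]
    rw [hlaw _ (by omega)] at h1 h2
    linarith [betaMix_nonneg P Z Z' τ]

/-- The expected number of scores with at least `c` scores below them is at most `m - c`. -/
theorem sum_prob_rank_le (P : Measure Ω) [IsProbabilityMeasure P] {n L : ℕ}
    {Z : Ω → Fin (n + 1) → α} (hZ : Measurable Z)
    {s : (Fin (L + 1) → α) → ℝ} (hs : Measurable s) (m : ℕ) {c : ℝ} (hc : c ≤ m) :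
    ∑ k ∈ Finset.range m,
      P.real {ω | c ≤ numBelow (score s (path (Z ω))) m (score s (path (Z ω)) k)} ≤ m - c := by
  let B : ℕ → Set Ω := fun k =>
    {ω | c ≤ numBelow (score s (path (Z ω))) m (score s (path (Z ω)) k)}
  have hB : ∀ k, MeasurableSet (B k) := fun k => measurableSet_le_numBelow hZ hs m k c
  have hint : ∀ k, Integrable ((B k).indicator fun _ => (1 : ℝ)) P := fun k =>
    (integrable_const (1 : ℝ)).indicator (hB k)
  calc ∑ k ∈ Finset.range m, P.real (B k)
      = ∑ k ∈ Finset.range m, ∫ ω, (B k).indicator (fun _ => (1 : ℝ)) ω ∂P := by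
        refine Finset.sum_congr rfl fun k _ => ?_
        rw [integral_indicator_const _ (hB k), smul_eq_mul, mul_one]
    _ = ∫ ω, ∑ k ∈ Finset.range m, (B k).indicator (fun _ => (1 : ℝ)) ω ∂P :=
        (integral_finsetSum _ fun k _ => hint k).symm
    _ ≤ ∫ _, ((m : ℝ) - c) ∂P := by
        refine integral_mono (integrable_finsetSum _ fun k _ => hint k) (integrable_const _)
          fun ω => ?_
        have h := card_le_numBelow (score s (path (Z ω))) m c hc
        rw [Finset.card_filter] at h
        push_cast at h
        simpa [Set.indicator_apply, B] using h
    _ = m - c := by simp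

end Coverage

/-- Corollary 1 (β-mixing part): pretrained conformal coverage for stationary β-mixing data
(stated for each `τ ≤ n - 2L`, equivalent to the `min` over `τ`). -/
theorem stmt12 {Ω α : Type*} [MeasurableSpace Ω] [MeasurableSpace α]
    (P : Measure Ω) [IsProbabilityMeasure P] {n L : ℕ} (hL : L < n)
    (Z Z' : Ω → Fin (n + 1) → α) (hZ : Measurable Z) (hZ' : Measurable Z')
    (hst : Stationary P Z) (hcopy : Measure.map Z' P = Measure.map Z P)
    (hindep : ProbabilityTheory.IndepFun Z Z' P)
    (s : (Fin (L + 1) → α) → ℝ) (hs : Measurable s)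
    (a : ℝ) (ha : 0 < a) (ha1 : a < 1) (τ : ℕ) (hτ : τ ≤ n - 2 * L) :
    (P {ω | (s (fun l : Fin (L + 1) => Z ω ⟨n - l.val, by omega⟩) : EReal)
          ≤ Quantile ((1 - a) * (1 + 1 / ((n : ℝ) - L)))
              (fun j : Fin (n - L) =>
                s fun l : Fin (L + 1) =>
                  Z ω ⟨L + j.val - l.val, by have := j.isLt; omega⟩)}).toReal
      ≥ 1 - a - (((τ : ℝ) + L) / ((n : ℝ) - L + 1) + 2 * betaMix P n Z Z' τ) := by
  have hbeta := betaMix_nonneg P Z Z' τ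
  have hLn : (L : ℝ) < n := by exact_mod_cast hL
  obtain ⟨M, hM⟩ : ∃ M, n = M + L := ⟨n - L, by omega⟩
  have hMn : (n : ℝ) - L = M := by rw [hM]; push_cast; ring
  have hM0 : 0 < M := by omega
  rw [hMn]
  have hm0 : (0 : ℝ) < (M : ℝ) + 1 := by positivity
  rcases Nat.lt_or_ge (τ + L) (M + 1) with hτM | hτM
  swap
  · have h1 : 1 ≤ ((τ : ℝ) + L) / ((M : ℝ) + 1) := by
      rw [one_le_div hm0]; exact_mod_cast hτM
    have h2 : 0 ≤ (P {ω | (s (fun l : Fin (L + 1) => Z ω ⟨n - l.val, by omega⟩) : EReal)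
          ≤ Quantile ((1 - a) * (1 + 1 / (M : ℝ)))
              (fun j : Fin (n - L) =>
                s fun l : Fin (L + 1) =>
                  Z ω ⟨L + j.val - l.val, by have := j.isLt; omega⟩)}).toReal :=
      ENNReal.toReal_nonneg
    linarith
  set miss : Set Ω := {ω | (1 - a) * ((M : ℝ) + 1) ≤
    numBelow (score s (path (Z ω))) (M + 1) (score s (path (Z ω)) M)} with hmiss
  have hmeas : MeasurableSet miss := measurableSet_le_numBelow hZ hs (M + 1) M _
  have hsum : ((M : ℝ) + 1) * P.real miss ≤
      (M + 1) - ((1 - a) * (M + 1) - (τ + L)) + (M + 1) * (2 * betaMix P n Z Z' τ) := by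
    have h1 : ∑ k ∈ Finset.range (M + 1), P.real miss ≤ ∑ k ∈ Finset.range (M + 1),
        (P.real {ω | (1 - a) * ((M : ℝ) + 1) - (τ + L) ≤
          numBelow (score s (path (Z ω))) (M + 1) (score s (path (Z ω)) k)} +
          2 * betaMix P n Z Z' τ) :=
      Finset.sum_le_sum fun k hk => prob_rank_last_le P hZ hZ' hst hcopy hindep hs (by omega) hτM
        (Finset.mem_range.1 hk) _
    have h2 := sum_prob_rank_le P hZ hs (M + 1) (c := (1 - a) * ((M : ℝ) + 1) - (τ + L)) (by
      push_cast
      nlinarith [(Nat.cast_nonneg τ : (0 : ℝ) ≤ τ), (Nat.cast_nonneg L : (0 : ℝ) ≤ L)])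
    rw [Finset.sum_add_distrib] at h1
    simp only [Finset.sum_const, Finset.card_range, nsmul_eq_mul] at h1
    push_cast at h1 h2
    linarith
  have hbound : P.real miss ≤ a + (((τ : ℝ) + L) / ((M : ℝ) + 1) + 2 * betaMix P n Z Z' τ) := by
    refine le_of_mul_le_mul_left (hsum.trans_eq ?_) hm0
    field_simp
    ring
  have hcov : P.real missᶜ ≤
      (P {ω | (s (fun l : Fin (L + 1) => Z ω ⟨n - l.val, by omega⟩) : EReal)
          ≤ Quantile ((1 - a) * (1 + 1 / (M : ℝ)))
              (fun j : Fin (n - L) =>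
                s fun l : Fin (L + 1) =>
                  Z ω ⟨L + j.val - l.val, by have := j.isLt; omega⟩)}).toReal := by
    refine measureReal_mono fun ω hω => ?_
    have h := le_Quantile_of_numBelow_lt hM0 ha1 (not_le.1 hω)
    have hlast : s (fun l : Fin (L + 1) => Z ω ⟨n - l.val, by omega⟩) =
        score s (path (Z ω)) M := by
      unfold score path
      congr 1; funext l; congr 2; omega
    have hvec : ∀ j : Fin (n - L), (s fun l : Fin (L + 1) =>
        Z ω ⟨L + j.val - l.val, by have := j.isLt; omega⟩) = score s (path (Z ω)) j := by
      intro j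
      unfold score path
      congr 1; funext l; congr 2
      have := j.isLt
      omega
    rw [Set.mem_ofPred_eq, hlast]
    simp only [hvec]
    obtain rfl : M = n - L := by omega
    exact h
  rw [probReal_compl_eq_one_sub hmeas] at hcov
  linarith
end

section
/- Split conformal coverage lower bound: in the split conformal setting with n = n_0 + n_1, memory L with n_1 ≥ L, trained score s = A(Z_1,...,Z_{n_0}), scores S_i = s(Z_i;Z_{i-1},...,Z_{i-L}) for i = n_0+L+1,...,n+1, and S_{split,τ*} := (S_{n_0+L+τ*+1},...,S_{n+1}), the coverage satisfies P(S_{n+1} ≤ Quantile_{(1-α)(1+1/(n_1-L))}(S_{n_0+L+1},...,S_n)) ≥ 1 − α − min_{τ,τ* ≥ 0, τ+τ* ≤ n_1-L} { (τ + α·τ*)/(n_1 − τ* − L + 1) + Ψ̄_τ(S_{split,τ*}) }. -/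
open MeasureTheory
open scoped ENNReal

theorem delta0_eq_comp {α : Type*} (m k τ : ℕ) (w : Fin m → α) :
    delta0 m k τ w = w ∘ delta0 m k τ id := by
  funext i
  simp only [delta0, Function.comp_apply, id]
  split_ifs <;> rfl

theorem delta1_eq_comp {α : Type*} (m k τ : ℕ) (w : Fin m → α) :
    delta1 m k τ w = w ∘ delta1 m k τ id := by
  funext i
  simp only [delta1, Function.comp_apply, id]
  split_ifs <;> rfl

theorem delta0_id_injective (m k τ : ℕ) : Function.Injective (delta0 m k τ id) := by
  intro i j h
  have hi := i.isLt
  have hj := j.isLt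
  simp only [delta0, id] at h
  ext
  split_ifs at h <;> simp only [Fin.mk.injEq] at h <;> omega

theorem delta1_id_injective {m k : ℕ} (hk : k ≤ m) (τ : ℕ) :
    Function.Injective (delta1 m k τ id) := by
  intro i j h
  have hi := i.isLt
  have hj := j.isLt
  simp only [delta1, id] at h
  ext
  split_ifs at h <;> simp only [Fin.mk.injEq] at h
  any_goals omega
  rw [Nat.mod_eq_of_lt (by omega), Nat.mod_eq_of_lt (by omega)] at h
  omega

theorem delta0_id_last {m k τ : ℕ} (hk : 1 ≤ k) (hτ : τ < m) :
    delta0 m k τ id ⟨m - τ - 1, by omega⟩ = ⟨m - 1, by omega⟩ := by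
  simp only [delta0, id]
  rw [if_neg (by omega)]
  ext
  simp only
  omega

theorem delta1_id_last {m k τ : ℕ} (hk : 1 ≤ k) (hkm : k ≤ m) (hτ : τ < m) :
    delta1 m k τ id ⟨m - τ - 1, by omega⟩ = ⟨k - 1, by omega⟩ := by
  simp only [delta1, id]
  ext
  split_ifs <;> simp only
  any_goals omega
  rw [Nat.mod_eq_of_lt (by omega)]
  omega

theorem measurable_delta1 {α : Type*} [MeasurableSpace α] (m k τ : ℕ) :
    Measurable (delta1 m k τ : (Fin m → α) → Fin (m - τ) → α) := by
  refine measurable_pi_lambda _ fun i => ?_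
  have : (fun w : Fin m → α => delta1 m k τ w i) = fun w => w (delta1 m k τ id i) := by
    funext w
    rw [delta1_eq_comp, Function.comp_apply]
  rw [this]
  exact measurable_pi_apply _

/-- If the `j`-th order statistic is below `x`, then at least `j` entries are below `x`. -/
theorem le_card_of_orderStat_lt {N : ℕ} (v : Fin N → ℝ) (x : ℝ) {j : ℕ} (hj : 1 ≤ j)
    (hjN : j ≤ N) (h : orderStat v j < x) :
    j ≤ (Finset.univ.filter fun i => v i < x).card := by
  set l := (List.ofFn v).mergeSort (fun x y => x ≤ y) with hl
  have hperm : l.Perm (List.ofFn v) := List.mergeSort_perm _ _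
  have hlen : l.length = N := by rw [hperm.length_eq, List.length_ofFn]
  have hsorted : l.Pairwise (· ≤ ·) := by
    simpa using List.pairwise_mergeSort (le := fun x y : ℝ => decide (x ≤ y))
      (by simpa using fun a b c => le_trans) (by simpa using le_total) (List.ofFn v)
  have hlt : l[j - 1]'(by omega) < x := by
    rw [orderStat, ← hl, List.getD_eq_getElem _ _ (by omega)] at h
    exact h
  have htake : (l.take j).countP (fun y => decide (y < x)) = j := by
    have hall : ∀ y ∈ l.take j, decide (y < x) = true := by
      intro y hy
      obtain ⟨i, hi, rfl⟩ := List.mem_take_iff_getElem.1 hy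
      have : l[i]'(by omega) ≤ l[j - 1]'(by omega) :=
        hsorted.rel_get_of_le (a := ⟨i, by omega⟩) (b := ⟨j - 1, by omega⟩)
          (by simp only [Fin.mk_le_mk]; omega)
      simpa using this.trans_lt hlt
    rw [List.countP_eq_length.2 hall, List.length_take]
    omega
  have hcount : l.countP (fun y => decide (y < x)) =
      (Finset.univ.filter fun i => v i < x).card := by
    rw [hperm.countP_eq, List.ofFn_eq_map, List.countP_map, List.countP_eq_length_filter,
      ← List.toFinset_card_of_nodup ((List.nodup_finRange N).filter _)]
    congr 1
    ext i
    simp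
  rw [← hcount, ← htake]
  exact (List.take_sublist j l).countP_le

/-- At most `m - c` entries of a vector of length `m` exceed at least `c` of its entries. -/
theorem card_filter_le_card_lt {m : ℕ} (w : Fin m → ℝ) (c : ℕ) :
    (Finset.univ.filter fun k => c ≤ (Finset.univ.filter fun i => w i < w k).card).card
      ≤ m - c := by
  set S := Finset.univ.filter fun k => c ≤ (Finset.univ.filter fun i => w i < w k).card with hS
  rcases S.eq_empty_or_nonempty with h | h
  · simp [h]
  · obtain ⟨k, hkS, hk⟩ := S.exists_min_image w h
    have hc := (Finset.mem_filter.1 hkS).2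
    have hdisj : Disjoint S (Finset.univ.filter fun i => w i < w k) := by
      refine Finset.disjoint_left.2 fun i hi hi' => ?_
      exact absurd (Finset.mem_filter.1 hi').2 (not_lt.2 (hk i hi))
    have := (Finset.card_union_of_disjoint hdisj).symm.trans_le (Finset.card_le_univ _)
    rw [Fintype.card_fin] at this
    omega

theorem card_filter_comp_le {ι κ : Type*} [Fintype ι] [Fintype κ] {σ : ι → κ}
    (hσ : Function.Injective σ) (p : κ → Prop) [DecidablePred p] :
    (Finset.univ.filter fun i => p (σ i)).card ≤ (Finset.univ.filter p).card :=
  Finset.card_le_card_of_injOn σ (fun i hi => by simpa using hi) hσ.injOn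

theorem card_filter_le_card_filter_comp {ι κ : Type*} [Fintype ι] [Fintype κ] {σ : ι → κ}
    (hσ : Function.Injective σ) (p : κ → Prop) [DecidablePred p] :
    (Finset.univ.filter p).card + Fintype.card ι
      ≤ (Finset.univ.filter fun i => p (σ i)).card + Fintype.card κ := by
  have hnot := card_filter_comp_le hσ fun b => ¬ p b
  have hι := Finset.card_filter_add_card_filter_not (s := (Finset.univ : Finset ι))
    fun i => p (σ i)
  have hκ := Finset.card_filter_add_card_filter_not (s := (Finset.univ : Finset κ)) p
  rw [Finset.card_univ] at hι hκ
  omega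

theorem measurableSet_le_card_lt {r : ℕ} (t : Fin r) (c : ℕ) :
    MeasurableSet {u : Fin r → ℝ | c ≤ (Finset.univ.filter fun i => u i < u t).card} := by
  have : Measurable fun u : Fin r → ℝ => (Finset.univ.filter fun i => u i < u t).card := by
    simp only [Finset.card_filter]
    exact Finset.measurable_sum _ fun i _ => Measurable.ite
      (measurableSet_lt (measurable_pi_apply i) (measurable_pi_apply t))
      measurable_const measurable_const
  exact this measurableSet_Ici

theorem toReal_le_add_dTV {Ω γ : Type*} [MeasurableSpace Ω] [MeasurableSpace γ]
    (P : Measure Ω) [IsProbabilityMeasure P] (U V : Ω → γ) {E : Set γ} (hE : MeasurableSet E) :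
    (P (U ⁻¹' E)).toReal ≤ (P (V ⁻¹' E)).toReal + dTV P U V := by
  have hle : ∀ s : Set Ω, (P s).toReal ≤ 1 := fun s =>
    ENNReal.toReal_le_of_le_ofReal zero_le_one (by simpa using prob_le_one)
  have hbdd : BddAbove (Set.range fun E : {E : Set γ // MeasurableSet E} =>
      |(P (U ⁻¹' E.1)).toReal - (P (V ⁻¹' E.1)).toReal|) := by
    refine ⟨1, ?_⟩
    rintro _ ⟨E, rfl⟩
    have hU := ENNReal.toReal_nonneg (a := P (U ⁻¹' E.1))
    have hV := ENNReal.toReal_nonneg (a := P (V ⁻¹' E.1))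
    exact abs_sub_le_iff.2
      ⟨by linarith [hle (U ⁻¹' E.1)], by linarith [hle (V ⁻¹' E.1)]⟩
  have hsup := le_ciSup hbdd ⟨E, hE⟩
  have habs := le_abs_self ((P (U ⁻¹' E)).toReal - (P (V ⁻¹' E)).toReal)
  rw [dTV]
  simp only at hsup
  linarith

/-- If at most `C` of the events `F k`, `k ∈ s`, can occur together, then the sum of their
probabilities is at most `C`. -/
theorem sum_toReal_le_of_card_le {Ω κ : Type*} [MeasurableSpace Ω] (P : Measure Ω)
    [IsProbabilityMeasure P] (s : Finset κ) {F : κ → Set Ω} (hF : ∀ k, MeasurableSet (F k))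
    {C : ℕ} (hC : ∀ ω, (∑ k ∈ s, (F k).indicator (fun _ => (1 : ℝ≥0∞)) ω) ≤ C) :
    ∑ k ∈ s, (P (F k)).toReal ≤ C := by
  have hsum : ∑ k ∈ s, P (F k) ≤ C := by
    calc ∑ k ∈ s, P (F k) = ∑ k ∈ s, ∫⁻ ω, (F k).indicator (fun _ => (1 : ℝ≥0∞)) ω ∂P := by
          refine Finset.sum_congr rfl fun k _ => ?_
          rw [lintegral_indicator_const (hF k), one_mul]
      _ = ∫⁻ ω, ∑ k ∈ s, (F k).indicator (fun _ => (1 : ℝ≥0∞)) ω ∂P :=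
          (lintegral_finsetSum _ fun k _ => measurable_const.indicator (hF k)).symm
      _ ≤ ∫⁻ _, (C : ℝ≥0∞) ∂P := lintegral_mono hC
      _ = C := by simp
  rw [← ENNReal.toReal_sum fun k _ => measure_ne_top P _]
  simpa using ENNReal.toReal_mono (ENNReal.natCast_ne_top C) hsum

/-- Bound on the probability that the last entry of a random vector exceeds at least `c` entries. -/
theorem toReal_le_card_lt_last_le {Ω : Type*} [MeasurableSpace Ω] (P : Measure Ω)
    [IsProbabilityMeasure P] {m τ : ℕ} (hτ : τ < m) {W : Ω → Fin m → ℝ} (hW : Measurable W)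
    (c : ℕ) {B : Set Ω}
    (hB : ∀ ω ∈ B, c ≤ (Finset.univ.filter fun i => W ω i < W ω ⟨m - 1, by omega⟩).card) :
    (P B).toReal ≤ ((m - (c - τ) : ℕ) : ℝ) / m + avgSwitchCoef P W τ := by
  set E : Set (Fin (m - τ) → ℝ) :=
    {u | c - τ ≤ (Finset.univ.filter fun i => u i < u ⟨m - τ - 1, by omega⟩).card} with hE_def
  have hE : MeasurableSet E := measurableSet_le_card_lt _ _
  have hbound : ∀ k ∈ Finset.Icc 1 m, (P B).toReal ≤
      (P ((fun ω => delta1 m k τ (W ω)) ⁻¹' E)).toReal + switchCoef P W k τ := by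
    intro k hk
    rw [Finset.mem_Icc] at hk
    refine le_trans ?_ (toReal_le_add_dTV P (fun ω => delta0 m k τ (W ω)) _ hE)
    refine ENNReal.toReal_mono (measure_ne_top P _) (measure_mono fun ω hω => ?_)
    have hc := hB ω hω
    have hcard := card_filter_le_card_filter_comp (delta0_id_injective m k τ)
      fun i => W ω i < W ω ⟨m - 1, by omega⟩
    rw [Fintype.card_fin, Fintype.card_fin] at hcard
    simp only [hE_def, Set.mem_preimage, Set.mem_ofPred_eq, delta0_eq_comp m k τ (W ω),
      Function.comp_apply, delta0_id_last hk.1 hτ]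
    omega
  have hsum : ∑ k ∈ Finset.Icc 1 m, (P ((fun ω => delta1 m k τ (W ω)) ⁻¹' E)).toReal
      ≤ (m - (c - τ) : ℕ) := by
    refine sum_toReal_le_of_card_le P _ (fun k => ((measurable_delta1 m k τ).comp hW) hE) ?_
    intro ω
    classical
    simp only [Set.indicator_apply, Finset.sum_boole]
    refine Nat.cast_le.2 (le_trans ?_ (card_filter_le_card_lt (W ω) (c - τ)))
    refine Finset.card_le_card_of_injOn (fun k => ⟨(k - 1) % m, Nat.mod_lt _ (by omega)⟩) ?_ ?_
    · intro k hk
      simp only [Finset.coe_filter, Finset.mem_Icc, Set.mem_ofPred_eq] at hk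
      obtain ⟨⟨hk1, hkm⟩, hk⟩ := hk
      simp only [hE_def, Set.mem_preimage, Set.mem_ofPred_eq, delta1_eq_comp m k τ (W ω),
        Function.comp_apply, delta1_id_last hk1 hkm hτ] at hk
      simp only [Finset.coe_filter, Finset.mem_univ, true_and, Set.mem_ofPred_eq,
        Nat.mod_eq_of_lt (show k - 1 < m by omega)]
      exact hk.trans (card_filter_comp_le (delta1_id_injective hkm τ)
        fun i => W ω i < W ω ⟨k - 1, by omega⟩)
    · intro k hk k' hk' h
      simp only [Finset.coe_filter, Finset.mem_Icc, Set.mem_ofPred_eq] at hk hk'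
      simp only [Fin.mk.injEq] at h
      rw [Nat.mod_eq_of_lt (by omega), Nat.mod_eq_of_lt (by omega)] at h
      omega
  have htotal := Finset.sum_le_sum hbound
  rw [Finset.sum_const, Nat.card_Icc, Nat.add_sub_cancel, nsmul_eq_mul,
    Finset.sum_add_distrib] at htotal
  have hm : (0 : ℝ) < m := by exact_mod_cast (by omega : 0 < m)
  rw [avgSwitchCoef, ← add_div, le_div_iff₀ hm]
  linarith

theorem coverage_ge {Ω : Type*} [MeasurableSpace Ω] (P : Measure Ω) [IsProbabilityMeasure P]
    {N : ℕ} (hN : 0 < N) {V : Ω → Fin (N + 1) → ℝ} (hV : Measurable V) {a : ℝ} (ha : 0 < a)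
    (ha1 : a < 1) {τ τs : ℕ} (hττs : τ + τs ≤ N) :
    1 - a - (((τ : ℝ) + a * τs) / ((N : ℝ) - τs + 1)
        + avgSwitchCoef P (fun ω (j : Fin (N + 1 - τs)) =>
            V ω ⟨τs + j.val, by have := j.isLt; omega⟩) τ)
      ≤ (P {ω | (V ω (Fin.last N) : EReal) ≤ Quantile ((1 - a) * (1 + 1 / (N : ℝ)))
          (fun j : Fin N => V ω j.castSucc)}).toReal := by
  set W : Ω → Fin (N + 1 - τs) → ℝ := fun ω j => V ω ⟨τs + j.val, by have := j.isLt; omega⟩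
    with hW_def
  have hW : Measurable W :=
    measurable_pi_lambda _ fun j => (measurable_pi_apply _).comp hV
  have hN' : (0 : ℝ) < N := by exact_mod_cast hN
  have hmcast : (N : ℝ) - τs + 1 = ((N + 1 - τs : ℕ) : ℝ) := by
    rw [Nat.cast_sub (by omega)]
    push_cast
    ring
  have hm : (0 : ℝ) < (N : ℝ) - τs + 1 := by
    rw [hmcast]
    exact_mod_cast (by omega : 0 < N + 1 - τs)
  set b := (1 - a) * (1 + 1 / (N : ℝ)) with hb
  have hbN : b * N = (1 - a) * (N + 1) := by rw [hb]; field_simp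
  have hb0 : 0 < b := by
    have : 0 < 1 - a := by linarith
    positivity
  set G := {ω | (V ω (Fin.last N) : EReal) ≤ Quantile b (fun j : Fin N => V ω j.castSucc)}
    with hG
  have hcompl : 1 ≤ (P G).toReal + (P Gᶜ).toReal := by
    have := measure_union_le (μ := P) G Gᶜ
    rw [Set.union_compl_self, measure_univ] at this
    rw [← ENNReal.toReal_add (measure_ne_top P _) (measure_ne_top P _)]
    simpa using ENNReal.toReal_mono
      (ENNReal.add_ne_top.2 ⟨measure_ne_top P _, measure_ne_top P _⟩) this
  have key : ∃ j : ℕ, (1 - a) * (N + 1) ≤ j ∧ j ≤ N + 1 ∧ ∀ ω ∈ Gᶜ,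
      j ≤ (Finset.univ.filter fun i => V ω i < V ω (Fin.last N)).card := by
    by_cases hb1 : b > 1
    · refine ⟨N + 1, ?_, le_rfl, fun ω hω => ?_⟩
      · push_cast
        nlinarith
      · exact absurd (by simp [hG, Quantile, hb1]) hω
    · refine ⟨⌈b * N⌉.toNat, ?_, ?_, fun ω hω => ?_⟩
      · rw [← hbN]
        exact (Int.le_ceil _).trans (by exact_mod_cast Int.self_le_toNat _)
      · have : ⌈b * N⌉ ≤ (N : ℤ) := Int.ceil_le.2 (by push_cast; nlinarith)
        omega
      · have hj1 : 0 < ⌈b * N⌉ := Int.ceil_pos.2 (by positivity)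
        have hjN : ⌈b * N⌉ ≤ (N : ℤ) := Int.ceil_le.2 (by push_cast; nlinarith)
        simp only [hG, Set.mem_compl_iff, Set.mem_ofPred_eq, Quantile, hb1, not_le.2 hb0,
          if_false, not_le, EReal.coe_lt_coe_iff] at hω
        exact (le_card_of_orderStat_lt _ _ (by omega) (by omega) hω).trans
          (card_filter_comp_le (Fin.castSucc_injective N) fun i => V ω i < V ω (Fin.last N))
  obtain ⟨j, hja, hjN, hj⟩ := key
  have hbound := toReal_le_card_lt_last_le P (τ := τ) (by omega) hW (j - τs) (B := Gᶜ) <| by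
    intro ω hω
    have hinj : Function.Injective
        (fun i : Fin (N + 1 - τs) => (⟨τs + i.val, by omega⟩ : Fin (N + 1))) := by
      intro i i' h
      simp only [Fin.mk.injEq] at h
      ext
      omega
    have hcard := card_filter_le_card_filter_comp hinj fun i => V ω i < V ω (Fin.last N)
    have hlast : (⟨τs + (N + 1 - τs - 1), by omega⟩ : Fin (N + 1)) = Fin.last N := by
      ext
      simp only [Fin.val_last]
      omega
    have := hj ω hω
    rw [Fintype.card_fin, Fintype.card_fin] at hcard
    simp only [hW_def, hlast]
    omega
  have hcount : ((N + 1 - τs - (j - τs - τ) : ℕ) : ℝ) ≤ N + 1 - j + τ := by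
    have : N + 1 - τs - (j - τs - τ) + j ≤ N + 1 + τ := by omega
    have : ((N + 1 - τs - (j - τs - τ) : ℕ) : ℝ) + j ≤ N + 1 + τ := by exact_mod_cast this
    linarith
  have hfrac : ((N + 1 - τs - (j - τs - τ) : ℕ) : ℝ) / (N + 1 - τs : ℕ)
      ≤ a + ((τ : ℝ) + a * τs) / ((N : ℝ) - τs + 1) := by
    rw [← hmcast, ← sub_le_iff_le_add', div_sub' hm.ne', div_le_div_iff_of_pos_right hm]
    linarith
  linarith

/-- Theorem 4: split conformal coverage lower bound, with the score function trained on the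
first `n₀` data points (stated for each `(τ, τ*)`, equivalent to the `min` over `(τ, τ*)`). -/
theorem stmt15 {Ω α : Type*} [MeasurableSpace Ω] [MeasurableSpace α]
    (P : Measure Ω) [IsProbabilityMeasure P] {n0 n1 L : ℕ} (hn0 : 1 ≤ n0) (hL : L < n1)
    (Z : Ω → Fin (n0 + n1 + 1) → α) (hZ : Measurable Z)
    (A : (Fin n0 → α) → (Fin (L + 1) → α) → ℝ)
    (hA : Measurable fun p : (Fin n0 → α) × (Fin (L + 1) → α) => A p.1 p.2)
    (a : ℝ) (ha : 0 < a) (ha1 : a < 1)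
    (τ τs : ℕ) (hττs : τ + τs ≤ n1 - L) :
    (P {ω | (A (fun t : Fin n0 => Z ω ⟨t.val, by have := t.isLt; omega⟩)
            (fun l : Fin (L + 1) => Z ω ⟨n0 + n1 - l.val, by omega⟩) : EReal)
          ≤ Quantile ((1 - a) * (1 + 1 / ((n1 : ℝ) - L)))
              (fun j : Fin (n1 - L) =>
                A (fun t : Fin n0 => Z ω ⟨t.val, by have := t.isLt; omega⟩)
                  (fun l : Fin (L + 1) =>
                    Z ω ⟨n0 + L + j.val - l.val, by have := j.isLt; omega⟩))}).toReal
      ≥ 1 - a - (((τ : ℝ) + a * τs) / ((n1 : ℝ) - τs - L + 1)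
          + avgSwitchCoef P (fun ω (j : Fin (n1 - L + 1 - τs)) =>
              A (fun t : Fin n0 => Z ω ⟨t.val, by have := t.isLt; omega⟩)
                (fun l : Fin (L + 1) =>
                  Z ω ⟨n0 + L + τs + j.val - l.val, by have := j.isLt; omega⟩)) τ) := by
  set V : Ω → Fin (n1 - L + 1) → ℝ := fun ω j =>
    A (fun t : Fin n0 => Z ω ⟨t.val, by omega⟩)
      (fun l : Fin (L + 1) => Z ω ⟨n0 + L + j.val - l.val, by omega⟩) with hV_def
  have hV : Measurable V := by
    refine measurable_pi_lambda _ fun j => hA.comp (Measurable.prodMk ?_ ?_)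
    · exact measurable_pi_lambda _ fun t => (measurable_pi_apply _).comp hZ
    · exact measurable_pi_lambda _ fun l => (measurable_pi_apply _).comp hZ
  have h := coverage_ge P (by omega) hV ha ha1 hττs
  have hlast : n0 + L + (n1 - L) = n0 + n1 := by omega
  rw [Nat.cast_sub hL.le, show (n1 : ℝ) - L - τs + 1 = n1 - τs - L + 1 by ring] at h
  simp only [hV_def, Fin.val_last, Fin.val_castSucc, ← Nat.add_assoc, hlast] at h
  exact h
end

section
/- Lower bound on coverage loss: fix α ∈ (0,1), n ≥ 1 with (1−α)(n+1) an integer, and b ∈ [0,1]. There exists a stationary time series Z ∈ Z^{n+1} (over a data space of cardinality |Z|, with K ≤ |Z| distinct points used) and a fixed score function s : Z → ℝ such that min_{τ ∈ {0,...,n}} { τ/(n+1) + 2β(τ) } ≤ b, yet P(s(Z_{n+1}) ≤ Quantile_{(1−α)(1+1/n)}(s(Z_1),...,s(Z_n))) ≤ (1 − b/4)(1−α) + n(n+1)/(2K). -/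
open MeasureTheory
open scoped ENNReal

section OrderStatistics

lemma card_filter_lt_lt_of_le_orderStat {m : ℕ} {v : Fin m → ℝ} {N : ℕ} (hN : 1 ≤ N)
    (hNm : N ≤ m) {x : ℝ} (hx : x ≤ orderStat v N) :
    (Finset.univ.filter fun i => v i < x).card < N := by
  unfold orderStat at hx
  set L := (List.ofFn v).mergeSort (fun x y => x ≤ y) with hL
  have hperm : L.Perm (List.ofFn v) := List.mergeSort_perm _ _
  have hlen : L.length = m := by simp [hL]
  have hlt : N - 1 < L.length := by omega
  have hsort : L.Pairwise (· ≤ ·) := List.pairwise_mergeSort' (r := (· ≤ ·)) _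
  rw [← List.getElem_eq_getD (h := hlt) 0] at hx
  have hcard : (Finset.univ.filter fun i => v i < x).card = L.countP (fun y => y < x) := by
    rw [hperm.countP_eq, ← Multiset.coe_countP, ← Fin.univ_val_map, Multiset.countP_map]
    simp [Finset.card_def]
  have hdrop : (L.drop (N - 1)).countP (fun y => y < x) = 0 := by
    rw [List.countP_eq_zero]
    intro y hy
    obtain ⟨i, hi, rfl⟩ := List.getElem_of_mem hy
    rw [List.getElem_drop]
    have hi' : N - 1 + i < L.length := by
      rw [List.length_drop] at hi
      omega
    have : L[N - 1] ≤ L[N - 1 + i] := hsort.sortedLE.monotone_get (a := ⟨N - 1, hlt⟩)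
      (b := ⟨N - 1 + i, hi'⟩) (by simp)
    simpa using hx.trans this
  have htake : (L.take (N - 1)).countP (fun y => y < x) ≤ N - 1 :=
    List.countP_le_length.trans (List.length_take_le _ _)
  have hsplit := List.countP_append (p := fun y => decide (y < x)) (l₁ := L.take (N - 1))
    (l₂ := L.drop (N - 1))
  rw [List.take_append_drop] at hsplit
  omega

/-- Among finitely many distinct reals, exactly the `N` smallest have fewer than `N` values
strictly below them. -/
lemma card_filter_rank_lt_le {ι : Type*} [Fintype ι] {v : ι → ℝ} (hv : Function.Injective v)
    (N : ℕ) :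
    (Finset.univ.filter fun j => (Finset.univ.filter fun i => v i < v j).card < N).card ≤ N := by
  rw [← Finset.card_range N]
  refine Finset.card_le_card_of_injOn (fun j => (Finset.univ.filter fun i => v i < v j).card)
    (fun j hj => by simpa using hj) ?_
  have key : ∀ {j k : ι}, v j < v k → (Finset.univ.filter fun i => v i < v j).card <
      (Finset.univ.filter fun i => v i < v k).card := fun {j k} hjk =>
    Finset.card_lt_card (Finset.ssubset_iff_of_subset
      (fun i hi => by simp only [Finset.mem_filter, Finset.mem_univ, true_and] at hi ⊢; linarith)
      |>.2 ⟨j, by simpa using hjk, by simp⟩)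
  intro j _ k _ hjk
  refine hv (le_antisymm ?_ ?_) <;> by_contra! h <;> exact (key h).ne (by simp_all)

lemma card_filter_lt_last_lt_of_le_quantile {n N : ℕ} (hn : 1 ≤ n) {a : ℝ} (ha : 0 < a)
    (ha1 : a < 1) (hN : (1 - a) * ((n : ℝ) + 1) = N) {v : Fin (n + 1) → ℝ}
    (h : (v (Fin.last n) : EReal) ≤
      Quantile ((1 - a) * (1 + 1 / (n : ℝ))) (fun i : Fin n => v i.castSucc)) :
    (Finset.univ.filter fun i => v i < v (Fin.last n)).card < N := by
  have hn0 : (0 : ℝ) < n := by exact_mod_cast hn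
  have hlevel : (1 - a) * (1 + 1 / (n : ℝ)) = N / n := by
    rw [← hN]; field_simp
  have hNpos : 1 ≤ N := by
    have : (0 : ℝ) < N := by rw [← hN]; exact mul_pos (by linarith) (by linarith)
    exact_mod_cast this
  have hNn : N ≤ n := by
    have : (N : ℝ) < n + 1 := by rw [← hN]; nlinarith
    exact Nat.lt_succ_iff.1 (by exact_mod_cast this)
  have hle : (N : ℝ) / n ≤ 1 := (div_le_one hn0).2 (by exact_mod_cast hNn)
  have hpos : (0 : ℝ) < N / n := div_pos (by exact_mod_cast hNpos) hn0
  rw [hlevel, Quantile, if_neg hle.not_gt, if_neg hpos.not_ge, EReal.coe_le_coe_iff,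
    div_mul_cancel₀ _ hn0.ne', Int.ceil_natCast, Int.toNat_natCast] at h
  have := card_filter_lt_lt_of_le_orderStat hNpos hNn h
  rwa [Finset.card_filter, Fin.sum_univ_castSucc, if_neg (lt_irrefl _), add_zero,
    ← Finset.card_filter]

end OrderStatistics

section Mixing

lemma dTV_le_one_sub {Ω γ : Type*} [MeasurableSpace Ω] [MeasurableSpace γ] {P : Measure Ω}
    [IsProbabilityMeasure P] {U V : Ω → γ} (hU : Measurable U) (hV : Measurable V)
    (Q : Measure γ) [IsProbabilityMeasure Q] {c : ℝ}
    (hQU : ∀ E, MeasurableSet E → c * Q.real E ≤ P.real (U ⁻¹' E))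
    (hQV : ∀ E, MeasurableSet E → c * Q.real E ≤ P.real (V ⁻¹' E)) :
    dTV P U V ≤ 1 - c := by
  have : Nonempty {E : Set γ // MeasurableSet E} := ⟨⟨∅, MeasurableSet.empty⟩⟩
  refine ciSup_le ?_
  rintro ⟨E, hE⟩
  have hUc : P.real (U ⁻¹' Eᶜ) = 1 - P.real (U ⁻¹' E) := probReal_compl_eq_one_sub (hU hE)
  have hVc : P.real (V ⁻¹' Eᶜ) = 1 - P.real (V ⁻¹' E) := probReal_compl_eq_one_sub (hV hE)
  have hQc : Q.real Eᶜ = 1 - Q.real E := probReal_compl_eq_one_sub hE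
  have h1 := hQU E hE
  have h2 := hQV E hE
  have h3 := hQU _ hE.compl
  have h4 := hQV _ hE.compl
  rw [hUc, hQc] at h3
  rw [hVc, hQc] at h4
  simp only [← measureReal_def]
  rw [abs_le]
  constructor <;> linarith

lemma map_splice_pi {ι 𝒵 : Type*} [Fintype ι] [MeasurableSpace 𝒵] (q : Measure 𝒵)
    [IsProbabilityMeasure q] (p : ι → Prop) [DecidablePred p] :
    ((Measure.pi fun _ : ι => q).prod (Measure.pi fun _ : ι => q)).map
      (fun w i => if p i then w.1 i else w.2 i) = Measure.pi fun _ => q := by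
  symm
  refine Measure.pi_eq fun s hs => ?_
  have hmeas : Measurable (fun (w : (ι → 𝒵) × (ι → 𝒵)) i => if p i then w.1 i else w.2 i) := by
    refine measurable_pi_lambda _ fun i => ?_
    split_ifs <;> fun_prop
  have hpre : (fun (w : (ι → 𝒵) × (ι → 𝒵)) i => if p i then w.1 i else w.2 i) ⁻¹' Set.univ.pi s =
      (Set.univ.pi fun i => if p i then s i else Set.univ) ×ˢ
        (Set.univ.pi fun i => if p i then Set.univ else s i) := by
    ext w
    simp only [Set.mem_preimage, Set.mem_univ_pi, Set.mem_prod, ← forall_and]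
    refine forall_congr' fun i => ?_
    split_ifs <;> simp
  rw [Measure.map_apply hmeas (MeasurableSet.univ_pi hs), hpre, Measure.prod_prod, Measure.pi_pi,
    Measure.pi_pi, ← Finset.prod_mul_distrib]
  refine Finset.prod_congr rfl fun i _ => ?_
  split_ifs <;> simp

lemma dTV_fst_splice_le {𝒵 : Type*} [MeasurableSpace 𝒵] {m : ℕ} {μ : Measure (Fin m → 𝒵)}
    [IsProbabilityMeasure μ] (q : Measure 𝒵) [IsProbabilityMeasure q] {r : NNReal}
    (hμ : r • Measure.pi (fun _ => q) ≤ μ) (k : ℕ) :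
    dTV (μ.prod μ) Prod.fst (fun w i => if i.val < k then w.1 i else w.2 i) ≤ 1 - (r : ℝ) ^ 2 := by
  set Q : Measure (Fin m → 𝒵) := Measure.pi fun _ => q
  have hreal : ∀ E, r * Q.real E ≤ μ.real E := fun E => by
    have := ENNReal.toReal_mono (measure_ne_top μ E) (hμ E)
    rwa [Measure.smul_apply, ENNReal.smul_def, smul_eq_mul, ENNReal.toReal_mul] at this
  have hr : (r : ℝ) ≤ 1 := by simpa using hreal Set.univ
  have hr0 : (0 : ℝ) ≤ r := r.2
  have hmeas : Measurable fun (w : (Fin m → 𝒵) × (Fin m → 𝒵)) (i : Fin m) =>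
      if i.val < k then w.1 i else w.2 i := by
    refine measurable_pi_lambda _ fun i => ?_
    split_ifs <;> fun_prop
  refine dTV_le_one_sub measurable_fst hmeas Q (fun E hE => ?_) (fun E hE => ?_)
  · have : (μ.prod μ).real (Prod.fst ⁻¹' E) = μ.real E := by
      rw [measureReal_def, ← Measure.map_apply measurable_fst hE, Measure.map_fst_prod]
      simp [measureReal_def]
    rw [this]
    refine le_trans ?_ (hreal E)
    exact mul_le_mul_of_nonneg_right (by nlinarith) measureReal_nonneg
  · have h1 : (r • Q).prod (r • Q) ≤ μ.prod μ := Measure.prod_mono hμ hμ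
    have h2 := ENNReal.toReal_mono (measure_ne_top _ _) (h1 ((fun w i =>
      if i.val < k then w.1 i else w.2 i) ⁻¹' E))
    rw [Measure.prod_smul_left, Measure.prod_smul_right, Measure.smul_apply, Measure.smul_apply,
      ← Measure.map_apply hmeas hE, map_splice_pi] at h2
    simpa [measureReal_def, ENNReal.smul_def, pow_two, mul_assoc] using h2

lemma betaMix_zero_le {𝒵 : Type*} [MeasurableSpace 𝒵] {n : ℕ} (hn : 1 ≤ n)
    {μ : Measure (Fin (n + 1) → 𝒵)} [IsProbabilityMeasure μ] (q : Measure 𝒵)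
    [IsProbabilityMeasure q] {r : NNReal} (hμ : r • Measure.pi (fun _ => q) ≤ μ) :
    betaMix (μ.prod μ) n Prod.fst Prod.snd 0 ≤ 1 - (r : ℝ) ^ 2 := by
  have : Nonempty (Fin (n - 0)) := ⟨⟨0, by omega⟩⟩
  refine ciSup_le fun k => le_of_eq_of_le ?_ (dTV_fst_splice_le q hμ (k + 1))
  refine congrArg₂ (dTV (μ.prod μ)) ?_ rfl
  funext w i
  exact ite_self (w.1 i)

end Mixing

section Stationarity

lemma map_comp_pi {ι κ 𝒵 : Type*} [Fintype ι] [Fintype κ] [MeasurableSpace 𝒵] (q : Measure 𝒵)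
    [IsProbabilityMeasure q] {g : κ → ι} (hg : Function.Injective g) :
    (Measure.pi fun _ : ι => q).map (fun w j => w (g j)) = Measure.pi fun _ => q := by
  have h := (ProbabilityTheory.iIndepFun_pi (μ := fun _ : ι => q) (X := fun _ x => x)
    (fun _ => aemeasurable_id)).precomp hg
  have h' := (ProbabilityTheory.iIndepFun_iff_map_fun_eq_pi_map
    (fun i => (measurable_pi_apply (g i)).aemeasurable)).1 h
  simpa [(measurePreserving_eval (fun _ : ι => q) _).map_eq] using h'

lemma stationary_pi {𝒵 : Type*} [MeasurableSpace 𝒵] (q : Measure 𝒵) [IsProbabilityMeasure q]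
    (n : ℕ) : Stationary (Measure.pi fun _ => q) (id : (Fin (n + 1) → 𝒵) → _) := by
  intro ℓ i h
  refine (map_comp_pi q ?_).trans (map_comp_pi q ?_).symm
  · intro j k hjk
    simpa [Fin.ext_iff] using hjk
  · intro j k hjk
    simpa [Fin.ext_iff] using hjk

lemma Stationary.add_smul {𝒵 : Type*} [MeasurableSpace 𝒵] {n : ℕ}
    {μ ν : Measure (Fin (n + 1) → 𝒵)} (hμ : Stationary μ id) (hν : Stationary ν id)
    (p r : NNReal) : Stationary (p • μ + r • ν) (id : (Fin (n + 1) → 𝒵) → _) := by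
  intro ℓ i h
  have h1 := hμ ℓ i h
  have h2 := hν ℓ i h
  rw [Measure.map_add _ _ (by fun_prop), Measure.map_add _ _ (by fun_prop), Measure.map_smul,
    Measure.map_smul, Measure.map_smul, Measure.map_smul, h1, h2]

/-- The uniform probability measure on `Fin K`. -/
noncomputable def unifFin (K : ℕ) : Measure (Fin K) := (K : ℝ≥0∞)⁻¹ • Measure.count

lemma unifFin_apply (K : ℕ) (s : Finset (Fin K)) :
    unifFin K (s : Set (Fin K)) = s.card / K := by
  rw [unifFin, Measure.smul_apply, Measure.count_apply_finset, smul_eq_mul, mul_comm,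
    ENNReal.div_eq_inv_mul, mul_comm]

instance unifFin.instIsProbabilityMeasure (K : ℕ) [NeZero K] :
    IsProbabilityMeasure (unifFin K) := by
  constructor
  rw [← Finset.coe_univ, unifFin_apply, Finset.card_univ, Fintype.card_fin]
  exact ENNReal.div_self (by simp [NeZero.ne]) (by simp)

lemma map_add_right_unifFin {K : ℕ} [NeZero K] (c : Fin K) :
    (unifFin K).map (fun J => J + c) = unifFin K := by
  ext s -
  rw [Measure.map_apply (measurable_of_finite _) s.toFinite.measurableSet, unifFin,
    Measure.smul_apply, Measure.smul_apply, Measure.count_apply s.toFinite.measurableSet,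
    Measure.count_apply (Set.toFinite _).measurableSet,
    Set.encard_preimage_of_bijective (f := fun J => J + c) (Equiv.addRight c).bijective]

/-- The window of length `m` of the periodic sequence `z 0, z 1, …, z (K - 1), z 0, …` that
starts at index `J`. -/
def cyclicPath {𝒵 : Type*} {K : ℕ} [NeZero K] (z : Fin K → 𝒵) (m : ℕ) (J : Fin K) :
    Fin m → 𝒵 :=
  fun i => z (J + Fin.ofNat K i)

lemma stationary_cyclicPath {𝒵 : Type*} [MeasurableSpace 𝒵] {K : ℕ} [NeZero K] (z : Fin K → 𝒵)
    (n : ℕ) : Stationary ((unifFin K).map (cyclicPath z (n + 1))) id := by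
  intro ℓ i h
  have hfin : ∀ {γ : Type _} [MeasurableSpace γ] (f : Fin K → γ), Measurable f :=
    fun f => measurable_of_finite f
  rw [Measure.map_map (by fun_prop) (hfin _), Measure.map_map (by fun_prop) (hfin _)]
  conv_rhs => rw [← map_add_right_unifFin (Fin.ofNat K i), 
    Measure.map_map (hfin _) (measurable_of_finite _)]
  congr 1
  funext J j
  simp only [Function.comp_apply, id, cyclicPath]
  congr 1
  ext
  simp [Fin.val_add, Nat.add_assoc]

end Stationarity

section Coverage

variable {𝒵 : Type*} [MeasurableSpace 𝒵] {s : 𝒵 → ℝ} {ε : ℝ≥0∞}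

lemma pi_tie_le {ι : Type*} [Fintype ι] {q : Measure 𝒵} [IsProbabilityMeasure q]
    (hs : Measurable s) (hq : ∀ c, q {y | s y = c} ≤ ε) {i j : ι} (hij : i ≠ j) :
    Measure.pi (fun _ => q) {w : ι → 𝒵 | s (w i) = s (w j)} ≤ ε := by
  have hindep := (ProbabilityTheory.iIndepFun_pi (μ := fun _ : ι => q) (X := fun _ x => x)
    (fun _ => aemeasurable_id)).indepFun hij
  have hmap := (ProbabilityTheory.indepFun_iff_map_prod_eq_prod_map_map
    (measurable_pi_apply i).aemeasurable (measurable_pi_apply j).aemeasurable).1 hindep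
  have heval : ∀ k, (Measure.pi fun _ : ι => q).map (fun w => w k) = q := fun k =>
    (measurePreserving_eval (fun _ : ι => q) k).map_eq
  rw [heval, heval] at hmap
  have hE : MeasurableSet {x : 𝒵 × 𝒵 | s x.1 = s x.2} :=
    measurableSet_eq_fun (by fun_prop) (by fun_prop)
  have hpre : {w : ι → 𝒵 | s (w i) = s (w j)} =
      (fun w => (w i, w j)) ⁻¹' {x : 𝒵 × 𝒵 | s x.1 = s x.2} := rfl
  rw [hpre, ← Measure.map_apply (by fun_prop) hE, hmap, Measure.prod_apply hE]
  calc ∫⁻ x, q (Prod.mk x ⁻¹' {x : 𝒵 × 𝒵 | s x.1 = s x.2}) ∂q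
      ≤ ∫⁻ _, ε ∂q := lintegral_mono fun x => by simpa [eq_comm] using hq (s x)
    _ = ε := by simp

lemma pi_not_injective_le {q : Measure 𝒵} [IsProbabilityMeasure q]
    (hs : Measurable s) (hq : ∀ c, q {y | s y = c} ≤ ε) (m : ℕ) :
    Measure.pi (fun _ => q) {w : Fin m → 𝒵 | ¬ Function.Injective fun i => s (w i)} ≤
      m.choose 2 * ε := by
  have hsub : {w : Fin m → 𝒵 | ¬ Function.Injective fun i => s (w i)} ⊆
      ⋃ j : Fin m, ⋃ i ∈ Finset.Iio j, {w | s (w i) = s (w j)} := by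
    intro w hw
    simp only [Set.mem_ofPred_eq, Function.Injective, not_forall] at hw
    obtain ⟨i, j, hij, hne⟩ := hw
    simp only [Set.mem_iUnion, Finset.mem_Iio, Set.mem_ofPred_eq, exists_prop]
    rcases lt_or_gt_of_ne hne with h | h
    · exact ⟨j, i, h, hij⟩
    · exact ⟨i, j, h, hij.symm⟩
  refine (measure_mono hsub).trans <| (measure_iUnion_fintype_le _ _).trans ?_
  calc ∑ j : Fin m, Measure.pi (fun _ => q) (⋃ i ∈ Finset.Iio j, {w | s (w i) = s (w j)})
      ≤ ∑ j : Fin m, ∑ i ∈ Finset.Iio j, ε := by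
        refine Finset.sum_le_sum fun j _ => (measure_biUnion_finset_le _ _).trans ?_
        exact Finset.sum_le_sum fun i hi => pi_tie_le hs hq (Finset.mem_Iio.1 hi).ne
    _ = m.choose 2 * ε := by
        simp only [Finset.sum_const, Fin.card_Iio, nsmul_eq_mul, ← Finset.sum_mul]
        rw [Fin.sum_univ_eq_sum_range (fun i => (i : ℝ≥0∞)), ← Nat.cast_sum,
          Finset.sum_range_id, Nat.choose_two_right]

lemma measurableSet_rank_lt {m : ℕ} (hs : Measurable s) (N : ℕ) (j : Fin m) :
    MeasurableSet {w : Fin m → 𝒵 |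
      (Finset.univ.filter fun i => s (w i) < s (w j)).card < N} := by
  have : Measurable fun w : Fin m → 𝒵 =>
      (Finset.univ.filter fun i => s (w i) < s (w j)).card := by
    simp only [Finset.card_filter]
    refine Finset.measurable_sum _ fun i _ => ?_
    exact Measurable.ite (measurableSet_lt (by fun_prop) (by fun_prop)) measurable_const
      measurable_const
  exact this (measurableSet_Iio (a := N))

lemma pi_rank_lt_eq {q : Measure 𝒵} [IsProbabilityMeasure q] (hs : Measurable s) {m : ℕ}
    (N : ℕ) (j k : Fin m) :
    Measure.pi (fun _ => q) {w : Fin m → 𝒵 |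
      (Finset.univ.filter fun i => s (w i) < s (w j)).card < N} =
    Measure.pi (fun _ => q) {w : Fin m → 𝒵 |
      (Finset.univ.filter fun i => s (w i) < s (w k)).card < N} := by
  conv_lhs => rw [← map_comp_pi q (Equiv.swap j k).injective]
  rw [Measure.map_apply (by fun_prop) (measurableSet_rank_lt hs N j)]
  congr 1
  ext w
  simp only [Set.mem_preimage, Set.mem_ofPred_eq, Equiv.swap_apply_left]
  rw [Finset.card_equiv (t := Finset.univ.filter fun i => s (w i) < s (w k)) (Equiv.swap j k)]
  simp

lemma pi_rank_lt_le {q : Measure 𝒵} [IsProbabilityMeasure q] (hs : Measurable s)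
    (hq : ∀ c, q {y | s y = c} ≤ ε) {m : ℕ} (N : ℕ) (k : Fin m) :
    (m : ℝ≥0∞) * Measure.pi (fun _ => q) {w : Fin m → 𝒵 |
      (Finset.univ.filter fun i => s (w i) < s (w k)).card < N} ≤ N + m * (m.choose 2 * ε) := by
  set Q : Measure (Fin m → 𝒵) := Measure.pi fun _ => q
  set A : Fin m → Set (Fin m → 𝒵) := fun j =>
    {w | (Finset.univ.filter fun i => s (w i) < s (w j)).card < N}
  set T : Set (Fin m → 𝒵) := {w | ¬ Function.Injective fun i => s (w i)}
  have hA : ∀ j, MeasurableSet (A j) := measurableSet_rank_lt hs N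
  calc (m : ℝ≥0∞) * Q (A k) = ∑ j, Q (A j) := by
        simp [show ∀ j, Q (A j) = Q (A k) from fun j => pi_rank_lt_eq hs N j k]
    _ = ∫⁻ w, ∑ j, (A j).indicator 1 w ∂Q := by
        rw [lintegral_finsetSum _ fun j _ => measurable_one.indicator (hA j)]
        simp [hA]
    _ ≤ ∫⁻ w, ((N : ℝ≥0∞) + m * (toMeasurable Q T).indicator 1 w) ∂Q := by
        refine lintegral_mono fun w => ?_
        have hsum : ∑ j, (A j).indicator (1 : (Fin m → 𝒵) → ℝ≥0∞) w =
            (Finset.univ.filter fun j => w ∈ A j).card := by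
          simp [Set.indicator_apply]
        rw [hsum]
        by_cases hw : w ∈ T
        · rw [Set.indicator_of_mem (subset_toMeasurable Q T hw), Pi.one_apply, mul_one]
          refine le_add_left ?_
          exact_mod_cast (Finset.card_le_univ _).trans (Fintype.card_fin m).le
        · refine le_add_right ?_
          exact_mod_cast card_filter_rank_lt_le (not_not.1 hw) N
    _ = N + m * Q T := by
        rw [lintegral_add_left measurable_const, lintegral_const_mul' _ _ (by simp),
          lintegral_indicator_one (measurableSet_toMeasurable _ _), measure_toMeasurable]
        simp [Q]
    _ ≤ N + m * (m.choose 2 * ε) := by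
        gcongr
        exact pi_not_injective_le hs hq m

lemma unifFin_wrap_le (K n : ℕ) : unifFin K {J | K ≤ J + n} ≤ n / K := by
  have : {J : Fin K | K ≤ J + n} = (Finset.univ.filter fun J : Fin K => K ≤ J + n : Finset _) := by
    ext; simp
  rw [this, unifFin_apply]
  gcongr
  refine le_of_le_of_eq ?_ (Finset.card_range n)
  refine Finset.card_le_card_of_injOn (fun J => K - 1 - J) (fun J hJ => ?_) fun J _ L _ h => ?_
  · simp only [Finset.coe_filter, Finset.mem_univ, true_and, Set.mem_ofPred_eq] at hJ
    have := J.isLt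
    simp only [Finset.coe_range, Set.mem_Iio]
    omega
  · have := J.isLt
    have := L.isLt
    simp only at h
    ext
    omega

lemma map_cyclicPath_rank_lt_le {K : ℕ} [NeZero K] {z : Fin K → 𝒵} (hs : Measurable s)
    (hsz : ∀ k, s (z k) = (k : ℕ)) {n N : ℕ} (hN : N ≤ n) :
    (unifFin K).map (cyclicPath z (n + 1)) {w : Fin (n + 1) → 𝒵 |
      (Finset.univ.filter fun i => s (w i) < s (w (Fin.last n))).card < N} ≤ n / K := by
  rw [Measure.map_apply (measurable_of_finite _) (measurableSet_rank_lt hs N _)]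
  refine (measure_mono fun J hJ => ?_).trans (unifFin_wrap_le K n)
  simp only [Set.mem_preimage, Set.mem_ofPred_eq] at hJ ⊢
  by_contra! hlt
  have hval : ∀ i : Fin (n + 1), s (cyclicPath z (n + 1) J i) = ((J + i : ℕ) : ℝ) := fun i => by
    have hi : (J : ℕ) + i < K := by have := i.isLt; omega
    rw [cyclicPath, hsz, Fin.val_add, Fin.val_ofNat, Nat.add_mod_mod, Nat.mod_eq_of_lt hi]
  have hcard : (Finset.univ.filter fun i : Fin (n + 1) => s (cyclicPath z (n + 1) J i) <
      s (cyclicPath z (n + 1) J (Fin.last n))) = Finset.Iio (Fin.last n) := by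
    ext i
    simp only [hval, Finset.mem_filter, Finset.mem_univ, true_and, Nat.cast_lt, Fin.val_last,
      Finset.mem_Iio, Fin.lt_def]
    omega
  rw [hcard, Fin.card_Iio, Fin.val_last] at hJ
  omega

end Coverage

/-- Theorem 2: lower bound on coverage loss. There is a stationary time series (built from
`K` distinct points of the data space) and a fixed score function such that
`min_τ {τ/(n+1) + 2β(τ)} ≤ b`, yet the pretrained conformal coverage is at most
`(1-b/4)(1-α) + n(n+1)/(2K)`. -/
theorem stmt18 {𝒵 : Type*} [MeasurableSpace 𝒵] [MeasurableSingletonClass 𝒵]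
    {n K : ℕ} (hn : 1 ≤ n) (hK : 1 ≤ K) (z : Fin K → 𝒵) (hz : Function.Injective z)
    (a : ℝ) (ha : 0 < a) (ha1 : a < 1) (hint : ∃ N : ℕ, (1 - a) * ((n : ℝ) + 1) = N)
    (b : ℝ) (hb0 : 0 ≤ b) (hb1 : b ≤ 1) :
    ∃ (μ : Measure (Fin (n + 1) → 𝒵)) (s : 𝒵 → ℝ),
      IsProbabilityMeasure μ ∧ Measurable s ∧
      Stationary μ (id : (Fin (n + 1) → 𝒵) → Fin (n + 1) → 𝒵) ∧
      (∃ τ ≤ n, (τ : ℝ) / ((n : ℝ) + 1)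
          + 2 * betaMix (μ.prod μ) n Prod.fst Prod.snd τ ≤ b) ∧
      (μ {w | (s (w (Fin.last n)) : EReal)
            ≤ Quantile ((1 - a) * (1 + 1 / (n : ℝ)))
                (fun i : Fin n => s (w i.castSucc))}).toReal
        ≤ (1 - b / 4) * (1 - a) + (n : ℝ) * ((n : ℝ) + 1) / (2 * K) := by
  classical
  obtain ⟨N, hN⟩ := hint
  have : NeZero K := ⟨by omega⟩
  have hzm : Measurable z := measurable_of_finite z
  set q : Measure 𝒵 := (unifFin K).map z with hqdef
  have hqprob : IsProbabilityMeasure q := Measure.isProbabilityMeasure_map hzm.aemeasurable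
  set C : Measure (Fin (n + 1) → 𝒵) := (unifFin K).map (cyclicPath z (n + 1))
  have hCprob : IsProbabilityMeasure C :=
    Measure.isProbabilityMeasure_map (measurable_of_finite _).aemeasurable
  set Q : Measure (Fin (n + 1) → 𝒵) := Measure.pi fun _ => q
  set s : 𝒵 → ℝ := fun y => ∑ k, Set.indicator {z k} (fun _ => ((k : ℕ) : ℝ)) y with hsdef
  have hs : Measurable s := Finset.measurable_sum _ fun k _ =>
    measurable_const.indicator (measurableSet_singleton _)
  have hsz : ∀ k, s (z k) = (k : ℕ) := fun k => by
    simp [hsdef, Set.indicator_apply, hz.eq_iff]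
  have hq : ∀ c, q {y | s y = c} ≤ (K : ℝ≥0∞)⁻¹ := fun c => by
    have hpre : z ⁻¹' {y | s y = c} =
        (Finset.univ.filter fun k : Fin K => ((k : ℕ) : ℝ) = c : Finset _) := by
      ext k; simp [hsz]
    have hmeas : MeasurableSet {y | s y = c} := hs (measurableSet_singleton c)
    rw [hqdef, Measure.map_apply hzm hmeas, hpre, unifFin_apply, ← one_div]
    gcongr
    rw [Nat.cast_le_one, Finset.card_le_one]
    intro k hk l hl
    simp only [Finset.mem_filter, Finset.mem_univ, true_and] at hk hl
    exact Fin.ext (by exact_mod_cast hk.trans hl.symm)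
  obtain ⟨p, hp⟩ : ∃ p : NNReal, (p : ℝ) = b / 4 := ⟨⟨b / 4, by linarith⟩, rfl⟩
  obtain ⟨r, hr⟩ : ∃ r : NNReal, (r : ℝ) = 1 - b / 4 := ⟨⟨1 - b / 4, by linarith⟩, rfl⟩
  have hpr : p + r = 1 := NNReal.eq (by push_cast; linarith)
  have hμ : IsProbabilityMeasure (p • C + r • Q) := by
    constructor
    simp only [Measure.add_apply, Measure.smul_apply, measure_univ, ENNReal.smul_def, smul_eq_mul,
      mul_one]
    exact_mod_cast hpr
  refine ⟨p • C + r • Q, s, hμ, hs,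
    (stationary_cyclicPath z n).add_smul (stationary_pi q n) p r, ⟨0, n.zero_le, ?_⟩, ?_⟩
  · have := betaMix_zero_le hn q (r := r) (μ := p • C + r • Q) (Measure.le_add_left le_rfl)
    rw [hr] at this
    rw [Nat.cast_zero, zero_div, zero_add]
    nlinarith
  · set A : Set (Fin (n + 1) → 𝒵) :=
      {w | (Finset.univ.filter fun i => s (w i) < s (w (Fin.last n))).card < N}
    have hn0 : (1 : ℝ) ≤ n := by exact_mod_cast hn
    have hK0 : (1 : ℝ) ≤ K := by exact_mod_cast hK
    have hNn : N ≤ n := by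
      have : (N : ℝ) < n + 1 := by rw [← hN]; nlinarith
      exact Nat.lt_succ_iff.1 (by exact_mod_cast this)
    have hCA : C.real A ≤ n / K := by
      have h := map_cyclicPath_rank_lt_le (z := z) hs hsz hNn
      simpa [measureReal_def] using ENNReal.toReal_mono
        (ENNReal.div_ne_top (by simp) (by simp [NeZero.ne])) h
    have hQA : Q.real A ≤ (1 - a) + (n : ℝ) * (n + 1) / (2 * K) := by
      have h := ENNReal.toReal_mono (by simp [ENNReal.mul_eq_top, NeZero.ne])
        (pi_rank_lt_le hs hq N (Fin.last n))
      rw [ENNReal.toReal_add (by simp) (by simp [ENNReal.mul_eq_top, NeZero.ne])] at h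
      simp only [ENNReal.toReal_mul, ENNReal.toReal_natCast, ENNReal.toReal_inv,
        Nat.cast_choose_two] at h
      push_cast at h
      rw [← hN] at h
      change ((n : ℝ) + 1) * Q.real A ≤ _ at h
      refine le_of_mul_le_mul_left (h.trans_eq ?_) (by linarith : (0 : ℝ) < n + 1)
      field_simp
      ring
    have hsub : {w : Fin (n + 1) → 𝒵 | (s (w (Fin.last n)) : EReal) ≤
        Quantile ((1 - a) * (1 + 1 / (n : ℝ))) fun i : Fin n => s (w i.castSucc)} ⊆ A :=
      fun w hw => card_filter_lt_last_lt_of_le_quantile (v := fun i => s (w i)) hn ha ha1 hN hw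
    refine (measureReal_mono hsub).trans ?_
    have hsplit : (p • C + r • Q).real A = b / 4 * C.real A + (1 - b / 4) * Q.real A := by
      rw [measureReal_add_apply, measureReal_nnreal_smul_apply, measureReal_nnreal_smul_apply,
        hp, hr]
    rw [hsplit]
    have hwrap : (n : ℝ) / K ≤ n * (n + 1) / (2 * K) := by
      rw [div_le_div_iff₀ (by linarith) (by linarith)]
      nlinarith [mul_nonneg (mul_nonneg (by linarith : (0 : ℝ) ≤ n) (by linarith : (0 : ℝ) ≤ K))
        (by linarith : (0 : ℝ) ≤ n - 1)]
    have h1 := mul_le_mul_of_nonneg_left (hCA.trans hwrap) (by linarith : 0 ≤ b / 4)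
    have h2 := mul_le_mul_of_nonneg_left hQA (by linarith : 0 ≤ 1 - b / 4)
    linarith
end
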